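/- arXiv:1602.08362 — 3 statements merged into one kernel-verified Lean document; each statement's English description precedes it below -/
import Mathlib

section
/- High probability of the entropy-typical projector for Markov-correlated states: For k = 1,…,m let τ_k := ∑_{i∈I} γ_i σ_k(i), a density matrix on ℂ^d, with spectral decomposition τ_k = ∑_{p=1}^d λ_{k,p} π_{k,p} (orthonormal eigenbasis, π_{k,p} rank-one). For ε > 0 define the entropy-typical projector Π_{ent,ε} on (ℂ^d)^{⊗m} as the sum, over all sequences (p_1,…,p_m) ∈ {1,…,d}^m with λ_{k,p_k} > 0 for every k and |∑_{k=1}^m (log₂ λ_{k,p_k} + S(τ_k))| ≤ m ε, of ⊗_{k=1}^m π_{k,p_k}. Then for every ε > 0 and every d there exist δ₀ > 0 and m₀ ∈ ℕ such that: whenever 0 < δ ≤ δ₀, m ≥ m₀, and the family (σ_k(i,i')) satisfies conditions (i)–(iii) with parameter δ, one has Tr(σ^{(m)} Π_{ent,ε}) > 1 − ε. -/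
open scoped BigOperators ComplexOrder Matrix

/-- The rank-one projection `|v⟩⟨v|` onto a (unit) vector `v ∈ ℂ^d`. -/
noncomputable def outerProj {d : ℕ} (v : Fin d → ℂ) : Matrix (Fin d) (Fin d) ℂ :=
  Matrix.vecMulVec v (star v)

/-- The tensor product `A₁ ⊗ ⋯ ⊗ A_m` of `d × d` matrices, as a matrix on
`(ℂ^d)^{⊗m} ≃ ℂ^(Fin m → Fin d)`. -/
noncomputable def matTensor {m d : ℕ} (A : Fin m → Matrix (Fin d) (Fin d) ℂ) :
    Matrix (Fin m → Fin d) (Fin m → Fin d) ℂ :=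
  Matrix.of fun x y => ∏ k, A k (x k) (y k)

/-- The Markov-correlated state
`σ^{(m)} = ∑_{i₁,…,i_{m+1}} γ_{i₁} σ₁(i₁,i₂) ⊗ ⋯ ⊗ σ_m(i_m,i_{m+1})`. -/
noncomputable def sigmaChain {I : Type*} [Fintype I] {d m : ℕ} (γ : I → ℝ)
    (σ : Fin m → I → I → Matrix (Fin d) (Fin d) ℂ) :
    Matrix (Fin m → Fin d) (Fin m → Fin d) ℂ :=
  ∑ i : Fin (m + 1) → I,
    ((γ (i 0) : ℂ)) • matTensor (fun k => σ k (i k.castSucc) (i k.succ))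

/-- The Shannon entropy (base 2) of an eigenvalue list. -/
noncomputable def shannonEntropy {d : ℕ} (lam : Fin d → ℝ) : ℝ :=
  -∑ p, lam p * Real.logb 2 (lam p)

/-- The entropy-typical projector `Π_{ent,ε}` on `(ℂ^d)^{⊗m}`: the sum, over all sequences
`(p₁,…,p_m)` with `λ_{k,p_k} > 0` for every `k` and
`|∑ₖ (log₂ λ_{k,p_k} + S(τ_k))| ≤ mε`, of `⊗ₖ π_{k,p_k}`. -/
noncomputable def entTypicalProj {d m : ℕ} (e : Fin m → Fin d → Fin d → ℂ)
    (lam : Fin m → Fin d → ℝ) (ε : ℝ) : Matrix (Fin m → Fin d) (Fin m → Fin d) ℂ :=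
  ∑ p : Fin m → Fin d,
    if (∀ k, 0 < lam k (p k)) ∧
        |∑ k, (Real.logb 2 (lam k (p k)) + shannonEntropy (lam k))| ≤ m * ε then
      matTensor fun k => outerProj (e k (p k))
    else 0


/-- Expectation of a function of the last index and of the sum of `X`, for the path measure. -/
noncomputable def pathE {I : Type*} [Fintype I] {d m : ℕ} (γ : I → ℝ)
    (q : Fin m → I → I → Fin d → ℝ) (X : Fin m → Fin d → ℝ) (h : I → ℝ → ℝ) : ℝ :=
  ∑ i : Fin (m + 1) → I, ∑ p : Fin m → Fin d,
    γ (i 0) * (∏ k, q k (i k.castSucc) (i k.succ) (p k)) * h (i (Fin.last m)) (∑ k, X k (p k))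

lemma pathE_succ {I : Type*} [Fintype I] {d m : ℕ} (γ : I → ℝ)
    (q : Fin (m + 1) → I → I → Fin d → ℝ) (X : Fin (m + 1) → Fin d → ℝ) (h : I → ℝ → ℝ) :
    pathE γ q X h = pathE γ (fun k => q k.castSucc) (fun k => X k.castSucc)
      (fun j s => ∑ j', ∑ p, q (Fin.last m) j j' p * h j' (s + X (Fin.last m) p)) := by
  unfold pathE
  rw [← (Fin.snocEquiv (fun _ : Fin (m + 2) => I)).sum_comp, Fintype.sum_prod_type,
    Finset.sum_comm]
  refine Finset.sum_congr rfl fun i _ => ?_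
  have : ∀ x : I, (∑ p : Fin (m + 1) → Fin d,
      γ ((Fin.snocEquiv (fun _ : Fin (m + 2) => I)) (x, i) 0) *
        (∏ k, q k ((Fin.snocEquiv (fun _ : Fin (m + 2) => I)) (x, i) k.castSucc)
          ((Fin.snocEquiv (fun _ : Fin (m + 2) => I)) (x, i) k.succ) (p k)) *
        h ((Fin.snocEquiv (fun _ : Fin (m + 2) => I)) (x, i) (Fin.last (m + 1)))
          (∑ k, X k (p k))) =
      ∑ p : Fin m → Fin d, ∑ y : Fin d, γ (i 0) *
        (∏ k : Fin m, q k.castSucc (i k.castSucc) (i k.succ) (p k)) *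
        (q (Fin.last m) (i (Fin.last m)) x y *
          h x (∑ k : Fin m, X k.castSucc (p k) + X (Fin.last m) y)) := by
    intro x
    rw [← (Fin.snocEquiv (fun _ : Fin (m + 1) => Fin d)).sum_comp, Fintype.sum_prod_type,
      Finset.sum_comm]
    refine Finset.sum_congr rfl fun p _ => Finset.sum_congr rfl fun y _ => ?_
    have h0 : (0 : Fin (m + 2)) = Fin.castSucc 0 := rfl
    simp only [Fin.snocEquiv_apply, Fin.prod_univ_castSucc, Fin.sum_univ_castSucc,
      Fin.succ_castSucc, Fin.succ_last, Fin.snoc_castSucc, Fin.snoc_last, h0]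
    ring
  rw [Finset.sum_congr rfl fun x _ => this x, Finset.sum_comm]
  refine Finset.sum_congr rfl fun p _ => ?_
  simp only [Finset.mul_sum]

lemma pathE_add {I : Type*} [Fintype I] {d m : ℕ} (γ : I → ℝ)
    (q : Fin m → I → I → Fin d → ℝ) (X : Fin m → Fin d → ℝ) (h h' : I → ℝ → ℝ) :
    pathE γ q X (fun j s => h j s + h' j s) = pathE γ q X h + pathE γ q X h' := by
  simp only [pathE, mul_add, Finset.sum_add_distrib]

lemma pathE_smul {I : Type*} [Fintype I] {d m : ℕ} (γ : I → ℝ)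
    (q : Fin m → I → I → Fin d → ℝ) (X : Fin m → Fin d → ℝ) (c : ℝ) (h : I → ℝ → ℝ) :
    pathE γ q X (fun j s => c * h j s) = c * pathE γ q X h := by
  simp only [pathE, Finset.mul_sum]
  refine Finset.sum_congr rfl fun p _ => Finset.sum_congr rfl fun y _ => ?_
  ring

lemma pathE_const {I : Type*} [Fintype I] {d m : ℕ} (γ : I → ℝ)
    (q : Fin m → I → I → Fin d → ℝ) (X : Fin m → Fin d → ℝ)
    (H2 : ∀ k j', ∑ j, γ j * ∑ p, q k j j' p = γ j') (u : I → ℝ) :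
    pathE γ q X (fun j _ => u j) = ∑ j, γ j * u j := by
  induction m generalizing u with
  | zero =>
    unfold pathE
    rw [← (Equiv.funUnique (Fin 1) I).symm.sum_comp]
    simp
  | succ m ih =>
    rw [pathE_succ, ih _ _ (fun k => H2 k.castSucc)]
    simp only [← Finset.sum_mul, Finset.mul_sum]
    rw [Finset.sum_comm]
    refine Finset.sum_congr rfl fun j' _ => ?_
    rw [← H2 (Fin.last m) j', Finset.sum_mul]
    refine Finset.sum_congr rfl fun j _ => ?_
    ring

lemma pathE_lin {I : Type*} [Fintype I] {d m : ℕ} (γ : I → ℝ)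
    (q : Fin m → I → I → Fin d → ℝ) (X : Fin m → Fin d → ℝ) (lam : Fin m → Fin d → ℝ)
    (η K : ℝ) (hη : 0 ≤ η) (hK : 0 ≤ K) (hγ : ∀ i, 0 ≤ γ i)
    (H0 : ∀ k j j' p, 0 ≤ q k j j' p)
    (H2 : ∀ k j', ∑ j, γ j * ∑ p, q k j j' p = γ j')
    (H3 : ∀ k j' p, |∑ j, γ j * q k j j' p - γ j' * lam k p| ≤ η * γ j' * lam k p)
    (H5 : ∀ k, ∑ p, lam k p * X k p = 0)
    (H6 : ∀ k, ∑ p, lam k p * |X k p| ≤ K) (u : I → ℝ) :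
    |pathE γ q X (fun j s => u j * s)| ≤ m * η * K * ∑ j, γ j * |u j| := by
  induction m generalizing u with
  | zero => simp [pathE]
  | succ m ih =>
    rw [pathE_succ]
    set L := Fin.last m
    have e1 : (fun (j : I) (s : ℝ) => ∑ j', ∑ p, q L j j' p * (u j' * (s + X L p))) =
        fun j s => (∑ j', (∑ p, q L j j' p) * u j') * s +
          ∑ j', ∑ p, q L j j' p * u j' * X L p := by
      funext j s
      simp only [Finset.sum_mul, ← Finset.sum_add_distrib]
      refine Finset.sum_congr rfl fun p _ => Finset.sum_congr rfl fun y _ => ?_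
      ring
    rw [e1, pathE_add γ _ _ (fun j s => (∑ j', (∑ p, q L j j' p) * u j') * s)
      (fun j _ => ∑ j', ∑ p, q L j j' p * u j' * X L p)]
    rw [pathE_const _ _ _ (fun k => H2 k.castSucc)]
    have i1 := ih (fun k => q k.castSucc) (fun k => X k.castSucc) (fun k => lam k.castSucc)
      (fun k => H0 _) (fun k => H2 _) (fun k => H3 _) (fun k => H5 _) (fun k => H6 _)
      (fun j => ∑ j', (∑ p, q L j j' p) * u j')
    have i2 : ∑ j, γ j * |∑ j', (∑ p, q L j j' p) * u j'| ≤ ∑ j, γ j * |u j| := by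
      calc _ ≤ ∑ j, γ j * ∑ j', (∑ p, q L j j' p) * |u j'| := by
            refine Finset.sum_le_sum fun j _ => mul_le_mul_of_nonneg_left ?_ (hγ j)
            refine (Finset.abs_sum_le_sum_abs _ _).trans (le_of_eq ?_)
            refine Finset.sum_congr rfl fun j' _ => ?_
            rw [abs_mul, abs_of_nonneg (Finset.sum_nonneg fun p _ => H0 L j j' p)]
        _ = _ := by
            simp only [Finset.mul_sum]
            rw [Finset.sum_comm]
            refine Finset.sum_congr rfl fun j' _ => ?_
            conv_rhs => rw [← H2 L j', Finset.sum_mul]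
            refine Finset.sum_congr rfl fun j _ => ?_
            ring
    have i3 : |∑ j, γ j * ∑ j', ∑ p, q L j j' p * u j' * X L p| ≤
        η * K * ∑ j, γ j * |u j| := by
      have e2 : ∑ j, γ j * ∑ j', ∑ p, q L j j' p * u j' * X L p =
          ∑ j', u j' * ∑ p, (∑ j, γ j * q L j j' p - γ j' * lam L p) * X L p := by
        have e3 : ∀ j', ∑ p, (∑ j, γ j * q L j j' p - γ j' * lam L p) * X L p =
            ∑ p, (∑ j, γ j * q L j j' p) * X L p := by
          intro j'
          simp only [sub_mul, Finset.sum_sub_distrib, mul_assoc, ← Finset.mul_sum, H5 L]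
          simp
        simp only [e3, Finset.mul_sum, Finset.sum_mul]
        rw [Finset.sum_comm]
        refine Finset.sum_congr rfl fun j' _ => ?_
        rw [Finset.sum_comm]
        refine Finset.sum_congr rfl fun p _ => Finset.sum_congr rfl fun y _ => ?_
        ring
      rw [e2, Finset.mul_sum]
      refine (Finset.abs_sum_le_sum_abs _ _).trans (Finset.sum_le_sum fun j' _ => ?_)
      rw [abs_mul]
      have : |∑ p, (∑ j, γ j * q L j j' p - γ j' * lam L p) * X L p| ≤ η * γ j' * K := by
        calc _ ≤ ∑ p, η * γ j' * (lam L p * |X L p|) := by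
              refine (Finset.abs_sum_le_sum_abs _ _).trans (Finset.sum_le_sum fun p _ => ?_)
              rw [abs_mul, ← mul_assoc]
              exact mul_le_mul_of_nonneg_right (H3 L j' p) (abs_nonneg _)
          _ ≤ _ := by
              rw [← Finset.mul_sum]
              exact mul_le_mul_of_nonneg_left (H6 L) (mul_nonneg hη (hγ j'))
      calc _ ≤ |u j'| * (η * γ j' * K) := mul_le_mul_of_nonneg_left this (abs_nonneg _)
        _ = _ := by ring
    have i4 : (m : ℝ) * η * K * ∑ j, γ j * |∑ j', (∑ p, q L j j' p) * u j'| ≤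
      m * η * K * ∑ j, γ j * |u j| := mul_le_mul_of_nonneg_left i2 (by positivity)
    refine (abs_add_le _ _).trans ((add_le_add (i1.trans i4) i3).trans (le_of_eq ?_))
    push_cast
    ring

lemma pathE_sq {I : Type*} [Fintype I] {d m : ℕ} (γ : I → ℝ)
    (q : Fin m → I → I → Fin d → ℝ) (X : Fin m → Fin d → ℝ) (lam : Fin m → Fin d → ℝ)
    (η K K2 : ℝ) (hη : 0 ≤ η) (hK : 0 ≤ K) (hγ : ∀ i, 0 ≤ γ i)
    (H0 : ∀ k j j' p, 0 ≤ q k j j' p)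
    (H1 : ∀ k j, ∑ j', ∑ p, q k j j' p = 1)
    (H2 : ∀ k j', ∑ j, γ j * ∑ p, q k j j' p = γ j')
    (H3 : ∀ k j' p, |∑ j, γ j * q k j j' p - γ j' * lam k p| ≤ η * γ j' * lam k p)
    (H4 : ∀ k p, ∑ j, γ j * ∑ j', q k j j' p = lam k p)
    (H5 : ∀ k, ∑ p, lam k p * X k p = 0)
    (H6 : ∀ k, ∑ p, lam k p * |X k p| ≤ K) 
    (H7 : ∀ k, ∑ p, lam k p * X k p ^ 2 ≤ K2) :
    pathE γ q X (fun _ s => s ^ 2) ≤ m * K2 + m ^ 2 * η * K ^ 2 := by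
  induction m with
  | zero => simp [pathE]
  | succ m ih =>
    rw [pathE_succ]
    set L := Fin.last m
    have marg : ∀ f : Fin d → ℝ, ∑ j, γ j * ∑ j', ∑ p, q L j j' p * f p =
        ∑ p, lam L p * f p := by
      intro f
      simp only [← H4, Finset.mul_sum, Finset.sum_mul]
      rw [Finset.sum_comm (s := (Finset.univ : Finset (Fin d)))]
      refine Finset.sum_congr rfl fun j _ => ?_
      rw [Finset.sum_comm]
      refine Finset.sum_congr rfl fun p _ => Finset.sum_congr rfl fun y _ => ?_
      ring
    have e1 : (fun (j : I) (s : ℝ) => ∑ j', ∑ p, q L j j' p * (s + X L p) ^ 2) =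
        fun j s => (s ^ 2 + 2 * ((∑ j', ∑ p, q L j j' p * X L p) * s)) +
          ∑ j', ∑ p, q L j j' p * X L p ^ 2 := by
      funext j s
      have : s ^ 2 = (∑ j', ∑ p, q L j j' p) * s ^ 2 := by rw [H1, one_mul]
      rw [this]
      simp only [Finset.sum_mul, Finset.mul_sum, ← Finset.sum_add_distrib]
      refine Finset.sum_congr rfl fun p _ => Finset.sum_congr rfl fun y _ => ?_
      ring
    rw [e1, pathE_add γ _ _ (fun j s => s ^ 2 + 2 * ((∑ j', ∑ p, q L j j' p * X L p) * s))
      (fun j _ => ∑ j', ∑ p, q L j j' p * X L p ^ 2),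
      pathE_add γ _ _ (fun j s => s ^ 2)
      (fun j s => 2 * ((∑ j', ∑ p, q L j j' p * X L p) * s)),
      pathE_smul γ _ _ 2 (fun j s => (∑ j', ∑ p, q L j j' p * X L p) * s),
      pathE_const _ _ _ (fun k => H2 k.castSucc), marg (fun p => X L p ^ 2)]
    have i1 := ih (fun k => q k.castSucc) (fun k => X k.castSucc) (fun k => lam k.castSucc)
      (fun k => H0 _) (fun k => H1 _) (fun k => H2 _) (fun k => H3 _) (fun k => H4 _)
      (fun k => H5 _) (fun k => H6 _) (fun k => H7 _)
    have i2 := pathE_lin γ (fun k => q k.castSucc) (fun k => X k.castSucc)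
      (fun k => lam k.castSucc) η K hη hK hγ
      (fun k => H0 _) (fun k => H2 _) (fun k => H3 _)
      (fun k => H5 _) (fun k => H6 _) (fun j => ∑ j', ∑ p, q L j j' p * X L p)
    have i3 : ∑ j, γ j * |∑ j', ∑ p, q L j j' p * X L p| ≤ K := by
      calc _ ≤ ∑ j, γ j * ∑ j', ∑ p, q L j j' p * |X L p| := by
            refine Finset.sum_le_sum fun j _ => mul_le_mul_of_nonneg_left ?_ (hγ j)
            refine (Finset.abs_sum_le_sum_abs _ _).trans (Finset.sum_le_sum fun j' _ => ?_)
            refine (Finset.abs_sum_le_sum_abs _ _).trans (Finset.sum_le_sum fun p _ => ?_)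
            rw [abs_mul, abs_of_nonneg (H0 L j j' p)]
        _ = _ := marg _
        _ ≤ K := H6 L
    have i4 := (le_abs_self _).trans
      (i2.trans (mul_le_mul_of_nonneg_left i3 (by positivity : 0 ≤ (m : ℝ) * η * K)))
    have i5 := H7 L
    have : 0 ≤ η * K ^ 2 := by positivity
    push_cast
    nlinarith


lemma mul_logb_sq_le (x : ℝ) (h0 : 0 ≤ x) (h1 : x ≤ 1) :
    x * Real.logb 2 x ^ 2 ≤ 4 / Real.log 2 ^ 2 := by
  have hl : 0 < Real.log 2 := Real.log_pos (by norm_num)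
  rcases h0.eq_or_lt with h | h
  · rw [← h]; simp; positivity
  · have hs : 0 < √x := Real.sqrt_pos.2 h
    have hs1 : √x ≤ 1 := Real.sqrt_le_one.2 h1
    have hb := Real.abs_log_mul_self_lt (√x) hs hs1
    have hb2 : (Real.log √x * √x) ^ 2 ≤ 1 := by
      rw [← sq_abs]; nlinarith [abs_nonneg (Real.log √x * √x)]
    have e : x * Real.log x ^ 2 = 4 * (Real.log √x * √x) ^ 2 := by
      rw [Real.log_sqrt h.le, mul_pow, Real.sq_sqrt h.le]; ring
    rw [Real.logb, div_pow, ← mul_div_assoc]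
    gcongr
    linarith

lemma classical_typical {I : Type*} [Fintype I] {d m : ℕ} (γ : I → ℝ)
    (q : Fin m → I → I → Fin d → ℝ) (lam : Fin m → Fin d → ℝ)
    (η ε : ℝ) (hη : 0 ≤ η) (hε : 0 < ε) (hm : 0 < m) (hγ : ∀ i, 0 ≤ γ i) (hγ1 : ∑ i, γ i = 1)
    (H0 : ∀ k j j' p, 0 ≤ q k j j' p)
    (H1 : ∀ k j, ∑ j', ∑ p, q k j j' p = 1)
    (H2 : ∀ k j', ∑ j, γ j * ∑ p, q k j j' p = γ j')
    (H3 : ∀ k j' p, |∑ j, γ j * q k j j' p - γ j' * lam k p| ≤ η * γ j' * lam k p)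
    (H4 : ∀ k p, ∑ j, γ j * ∑ j', q k j j' p = lam k p) :
    1 - (m * (d * (4 / Real.log 2 ^ 2)) + m ^ 2 * η * (1 + d * (4 / Real.log 2 ^ 2)) ^ 2)
        / (m * ε) ^ 2 ≤
      ∑ i : Fin (m + 1) → I, ∑ p : Fin m → Fin d,
        γ (i 0) * (∏ k, q k (i k.castSucc) (i k.succ) (p k)) *
        (if (∀ k, 0 < lam k (p k)) ∧
          |∑ k, (Real.logb 2 (lam k (p k)) + shannonEntropy (lam k))| ≤ m * ε
          then 1 else 0) := by
  classical
  have hl0 : ∀ k p, 0 ≤ lam k p := by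
    intro k p
    rw [← H4]
    exact Finset.sum_nonneg fun j _ => mul_nonneg (hγ j) (Finset.sum_nonneg fun _ _ => H0 _ _ _ _)
  have hls : ∀ k, ∑ p, lam k p = 1 := by
    intro k
    simp only [← H4]
    rw [Finset.sum_comm, ← hγ1]
    refine Finset.sum_congr rfl fun j _ => ?_
    rw [← Finset.mul_sum, Finset.sum_comm, H1, mul_one]
  have hl1 : ∀ k p, lam k p ≤ 1 := by
    intro k p
    rw [← hls k]
    exact Finset.single_le_sum (fun p _ => hl0 k p) (Finset.mem_univ p)
  set K2 : ℝ := d * (4 / Real.log 2 ^ 2) with hK2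
  have hK20 : 0 ≤ K2 := by positivity
  set X : Fin m → Fin d → ℝ := fun k p => Real.logb 2 (lam k p) + shannonEntropy (lam k) with hX
  set N : Fin m → Fin d → ℝ := fun k p => if 0 < lam k p then 0 else 1 with hN
  have X5 : ∀ k, ∑ p, lam k p * X k p = 0 := by
    intro k
    simp only [hX, mul_add, Finset.sum_add_distrib, ← Finset.sum_mul, hls]
    simp [shannonEntropy]
  have X7 : ∀ k, ∑ p, lam k p * X k p ^ 2 ≤ K2 := by
    intro k
    have e : ∑ p, lam k p * X k p ^ 2 =
        ∑ p, lam k p * Real.logb 2 (lam k p) ^ 2 - shannonEntropy (lam k) ^ 2 := by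
      have e1 : ∀ p, lam k p * X k p ^ 2 = lam k p * Real.logb 2 (lam k p) ^ 2 +
          2 * shannonEntropy (lam k) * (lam k p * X k p) -
          lam k p * shannonEntropy (lam k) ^ 2 := by
        intro p; simp only [hX]; ring
      simp only [e1, Finset.sum_add_distrib, Finset.sum_sub_distrib, ← Finset.mul_sum,
        ← Finset.sum_mul, X5, hls]
      ring
    have b : ∑ p, lam k p * Real.logb 2 (lam k p) ^ 2 ≤ K2 := by
      calc _ ≤ ∑ _p : Fin d, 4 / Real.log 2 ^ 2 :=
            Finset.sum_le_sum fun p _ => mul_logb_sq_le _ (hl0 k p) (hl1 k p)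
        _ = K2 := by simp [hK2]
    rw [e]
    nlinarith [sq_nonneg (shannonEntropy (lam k))]
  have X6 : ∀ k, ∑ p, lam k p * |X k p| ≤ 1 + K2 := by
    intro k
    calc _ ≤ ∑ p, (lam k p + lam k p * X k p ^ 2) := by
          refine Finset.sum_le_sum fun p _ => ?_
          rw [← mul_one_add]
          refine mul_le_mul_of_nonneg_left ?_ (hl0 k p)
          nlinarith [sq_abs (X k p), sq_nonneg (|X k p| - 1), abs_nonneg (X k p)]
      _ ≤ _ := by
          rw [Finset.sum_add_distrib, hls]
          linarith [X7 k]
  have Nz : ∀ k p, lam k p * N k p = 0 := by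
    intro k p
    simp only [hN]
    split_ifs with h
    · simp
    · rw [le_antisymm (not_lt.1 h) (hl0 k p)]; simp
  have N0 : ∀ k p, 0 ≤ N k p := by
    intro k p; simp only [hN]; split_ifs <;> norm_num
  have vX := pathE_sq γ q X lam η (1 + K2) K2 hη (by linarith) hγ H0 H1 H2 H3 H4 X5 X6 X7
  have vN := pathE_sq γ q N lam η 0 0 hη le_rfl hγ H0 H1 H2 H3 H4
    (fun k => by simp [Nz]) (fun k => by simp [abs_of_nonneg (N0 _ _), Nz])
    (fun k => by simp [pow_two, ← mul_assoc, Nz])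
  have v1 := pathE_const γ q X H2 (fun _ => 1)
  simp only [mul_one, hγ1] at v1
  have hmε : 0 < m * ε := by positivity
  have key : pathE γ q X (fun _ _ => 1) ≤
      (∑ i : Fin (m + 1) → I, ∑ p : Fin m → Fin d,
        γ (i 0) * (∏ k, q k (i k.castSucc) (i k.succ) (p k)) *
        (if (∀ k, 0 < lam k (p k)) ∧ |∑ k, X k (p k)| ≤ m * ε then 1 else 0)) +
      pathE γ q X (fun _ s => (1 / (m * ε) ^ 2) * s ^ 2) + pathE γ q N (fun _ s => s ^ 2) := by
    unfold pathE
    simp only [← Finset.sum_add_distrib, ← mul_add]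
    refine Finset.sum_le_sum fun i _ => Finset.sum_le_sum fun p _ => ?_
    refine mul_le_mul_of_nonneg_left ?_
      (mul_nonneg (hγ _) (Finset.prod_nonneg fun k _ => H0 _ _ _ _))
    split_ifs with h
    · have : 0 ≤ 1 / (m * ε) ^ 2 * (∑ k, X k (p k)) ^ 2 := by positivity
      nlinarith [sq_nonneg (∑ k, N k (p k))]
    · by_cases h1 : ∀ k, 0 < lam k (p k)
      · have h2 : m * ε < |∑ k, X k (p k)| := by
          by_contra h2; exact h ⟨h1, not_lt.1 h2⟩
        have h3 : 1 ≤ 1 / (m * ε) ^ 2 * (∑ k, X k (p k)) ^ 2 := by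
          rw [div_mul_eq_mul_div, one_mul, one_le_div (by positivity), ← sq_abs (∑ k, X k (p k))]
          exact pow_le_pow_left₀ hmε.le h2.le 2
        nlinarith [sq_nonneg (∑ k, N k (p k))]
      · push Not at h1
        obtain ⟨k, hk⟩ := h1
        have h2 : 1 ≤ ∑ k, N k (p k) := by
          have h3 : N k (p k) = 1 := by simp [hN, not_lt.2 hk]
          rw [← h3]
          exact Finset.single_le_sum (f := fun k => N k (p k)) (fun k _ => N0 k _)
            (Finset.mem_univ k)
        have : 0 ≤ 1 / (m * ε) ^ 2 * (∑ k, X k (p k)) ^ 2 := by positivity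
        nlinarith
  rw [pathE_smul γ q X _ (fun _ s => s ^ 2), v1] at key
  have h4 : 1 / (m * ε) ^ 2 * pathE γ q X (fun _ s => s ^ 2) ≤
      (m * K2 + m ^ 2 * η * (1 + K2) ^ 2) / (m * ε) ^ 2 := by
    rw [div_mul_eq_mul_div, one_mul]
    gcongr
  have vN' : pathE γ q N (fun _ s => s ^ 2) ≤ 0 := by simpa using vN
  linarith

lemma trace_matTensor_mul {m d : ℕ} (A B : Fin m → Matrix (Fin d) (Fin d) ℂ) :
    Matrix.trace (matTensor A * matTensor B) = ∏ k, Matrix.trace (A k * B k) := by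
  simp only [Matrix.trace, Matrix.diag_apply, Matrix.mul_apply, matTensor, Matrix.of_apply,
    ← Finset.prod_mul_distrib]
  simp only [Finset.prod_univ_sum, Fintype.piFinset_univ]

lemma trace_mul_outerProj {d : ℕ} (A : Matrix (Fin d) (Fin d) ℂ) (v : Fin d → ℂ) :
    Matrix.trace (A * outerProj v) = star v ⬝ᵥ (A *ᵥ v) := by
  rw [outerProj, Matrix.mul_vecMulVec, Matrix.trace_vecMulVec, dotProduct_comm]

lemma trace_mul_outerProj_nonneg {d : ℕ} (A : Matrix (Fin d) (Fin d) ℂ) (hA : A.PosSemidef)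
    (v : Fin d → ℂ) : 0 ≤ Matrix.trace (A * outerProj v) := by
  rw [trace_mul_outerProj]
  exact hA.dotProduct_mulVec_nonneg v

lemma sum_outerProj {d : ℕ} (e : Fin d → Fin d → ℂ)
    (he : ∀ p q, (star (e p)) ⬝ᵥ e q = if p = q then 1 else 0) :
    ∑ p, outerProj (e p) = 1 := by
  have h1 : (Matrix.of e).map star * (Matrix.of e)ᵀ = 1 := by
    ext p q
    rw [Matrix.mul_apply, Matrix.one_apply, ← he p q]
    rfl
  rw [mul_eq_one_comm] at h1
  rw [← h1]
  ext x y
  simp [Matrix.sum_apply, outerProj, Matrix.vecMulVec_apply, Matrix.mul_apply]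

theorem entTypicalProj_high_probability (d : ℕ) (ε : ℝ) (hε : 0 < ε) :
    ∃ δ₀ > (0 : ℝ), ∃ m₀ : ℕ, ∀ (δ : ℝ), 0 < δ → δ ≤ δ₀ → ∀ m ≥ m₀,
      ∀ (I : Type) (_ : Fintype I) (γ : I → ℝ),
        (∀ i, 0 ≤ γ i) → (∑ i, γ i = 1) →
      ∀ (σ : Fin m → I → I → Matrix (Fin d) (Fin d) ℂ),
        (∀ k i i', (σ k i i').PosSemidef) →
        (∀ k i', ∑ i, (γ i : ℂ) * Matrix.trace (σ k i i') = (γ i' : ℂ)) →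
        (∀ k i, Matrix.trace (∑ i', σ k i i') = 1) →
        (∀ k i i',
          (σ k i i' - (((1 - δ ^ 3) * γ i' : ℝ) : ℂ) • ∑ i'', σ k i i'').PosSemidef) →
        (∀ k i i',
          ((((1 + δ ^ 3) * γ i' : ℝ) : ℂ) • (∑ i'', σ k i i'') - σ k i i').PosSemidef) →
      ∀ (e : Fin m → Fin d → Fin d → ℂ) (lam : Fin m → Fin d → ℝ),
        (∀ k p q, (star (e k p)) ⬝ᵥ e k q = if p = q then 1 else 0) →
        (∀ k, ∑ i, (γ i : ℂ) • ∑ i', σ k i i' = ∑ p, (lam k p : ℂ) • outerProj (e k p)) →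
      1 - ε < (Matrix.trace (sigmaChain γ σ * entTypicalProj e lam ε)).re := by
  set K2 : ℝ := d * (4 / Real.log 2 ^ 2) with hK2
  have hK20 : 0 ≤ K2 := by positivity
  have hKp : 0 < 4 * (1 + K2) ^ 2 := by positivity
  refine ⟨min 1 (ε ^ 3 / (4 * (1 + K2) ^ 2)), by positivity, ⌈4 * K2 / ε ^ 3⌉₊ + 1, ?_⟩
  intro δ hδ hδ0 m hm I _ γ hγ hγ1 σ hσ hi hii hlo hhi e lam he hτ
  have hmp : 0 < m := by omega
  have hmR : (0 : ℝ) < m := by exact_mod_cast hmp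
  set q : Fin m → I → I → Fin d → ℝ :=
    fun k i i' p => (Matrix.trace (σ k i i' * outerProj (e k p))).re with hq
  have hqc : ∀ k i i' p, Matrix.trace (σ k i i' * outerProj (e k p)) = (q k i i' p : ℂ) := by
    intro k i i' p
    have := trace_mul_outerProj_nonneg _ (hσ k i i') (e k p)
    exact (Complex.eq_re_of_ofReal_le (by exact_mod_cast this))
  have H0 : ∀ k i i' p, 0 ≤ q k i i' p := fun k i i' p =>
    (Complex.nonneg_iff.1 (trace_mul_outerProj_nonneg _ (hσ k i i') (e k p))).1
  have hqs : ∀ k i i', ((∑ p, q k i i' p : ℝ) : ℂ) = Matrix.trace (σ k i i') := by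
    intro k i i'
    push_cast
    simp only [← hqc]
    rw [← Matrix.trace_sum, ← Finset.mul_sum, sum_outerProj _ (he k), mul_one]
  have H1 : ∀ k i, ∑ i', ∑ p, q k i i' p = 1 := by
    intro k i
    have := hii k i
    rw [Matrix.trace_sum] at this
    simp only [← hqs] at this
    exact_mod_cast this
  have H2 : ∀ k j', ∑ j, γ j * ∑ p, q k j j' p = γ j' := by
    intro k j'
    have := hi k j'
    simp only [← hqs] at this
    exact_mod_cast this
  have hrow : ∀ k j p, Matrix.trace ((∑ j', σ k j j') * outerProj (e k p)) =
      ((∑ j', q k j j' p : ℝ) : ℂ) := by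
    intro k j p
    push_cast
    rw [Finset.sum_mul, Matrix.trace_sum]
    simp only [hqc]
  have H4 : ∀ k p, ∑ j, γ j * ∑ j', q k j j' p = lam k p := by
    intro k p
    have h1 := congrArg (fun M => Matrix.trace (M * outerProj (e k p))) (hτ k)
    simp only [Finset.sum_mul, Matrix.trace_sum, Matrix.smul_mul, Matrix.trace_smul] at h1
    have h2 : ∀ r, Matrix.trace (outerProj (e k r) * outerProj (e k p)) =
        if r = p then 1 else 0 := by
      intro r
      rw [trace_mul_outerProj, outerProj, Matrix.vecMulVec_mulVec, he k r p]
      split_ifs with h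
      · subst h; simp [he k r r]
      · simp
    simp only [h2, hqc, smul_eq_mul] at h1
    simp at h1
    exact_mod_cast h1
  have hup : ∀ k j j' p, q k j j' p ≤ (1 + δ ^ 3) * γ j' * ∑ j'', q k j j'' p := by
    intro k j j' p
    have := trace_mul_outerProj_nonneg _ (hhi k j j') (e k p)
    rw [sub_mul, Matrix.smul_mul, Matrix.trace_sub, Matrix.trace_smul, hrow, hqc,
      smul_eq_mul] at this
    have h3 : 0 ≤ (1 + δ ^ 3) * γ j' * ∑ j'', q k j j'' p - q k j j' p := by exact_mod_cast this
    linarith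
  have hdn : ∀ k j j' p, (1 - δ ^ 3) * γ j' * ∑ j'', q k j j'' p ≤ q k j j' p := by
    intro k j j' p
    have := trace_mul_outerProj_nonneg _ (hlo k j j') (e k p)
    rw [sub_mul, Matrix.smul_mul, Matrix.trace_sub, Matrix.trace_smul, hrow, hqc,
      smul_eq_mul] at this
    have h3 : 0 ≤ q k j j' p - (1 - δ ^ 3) * γ j' * ∑ j'', q k j j'' p := by exact_mod_cast this
    linarith
  have H3 : ∀ k j' p, |∑ j, γ j * q k j j' p - γ j' * lam k p| ≤ δ ^ 3 * γ j' * lam k p := by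
    intro k j' p
    have u1 : ∑ j, γ j * q k j j' p ≤ (1 + δ ^ 3) * γ j' * lam k p := by
      rw [← H4 k p, Finset.mul_sum]
      refine Finset.sum_le_sum fun j _ => ?_
      have := mul_le_mul_of_nonneg_left (hup k j j' p) (hγ j)
      linarith
    have u2 : (1 - δ ^ 3) * γ j' * lam k p ≤ ∑ j, γ j * q k j j' p := by
      rw [← H4 k p, Finset.mul_sum]
      refine Finset.sum_le_sum fun j _ => ?_
      have := mul_le_mul_of_nonneg_left (hdn k j j' p) (hγ j)
      linarith
    rw [abs_le]
    constructor <;> linarith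
  have hδ3 : 0 ≤ δ ^ 3 := by positivity
  have main := classical_typical γ q lam (δ ^ 3) ε hδ3 hε hmp hγ hγ1 H0 H1 H2 H3 H4
  rw [← hK2] at main
  have htr : Matrix.trace (sigmaChain γ σ * entTypicalProj e lam ε) =
      ((∑ i : Fin (m + 1) → I, ∑ p : Fin m → Fin d,
        γ (i 0) * (∏ k, q k (i k.castSucc) (i k.succ) (p k)) *
        (if (∀ k, 0 < lam k (p k)) ∧
          |∑ k, (Real.logb 2 (lam k (p k)) + shannonEntropy (lam k))| ≤ m * ε
          then 1 else 0) : ℝ) : ℂ) := by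
    rw [sigmaChain, entTypicalProj]
    rw [Finset.sum_mul, Matrix.trace_sum, Complex.ofReal_sum]
    refine Finset.sum_congr rfl fun i _ => ?_
    rw [Finset.mul_sum, Matrix.trace_sum, Complex.ofReal_sum]
    refine Finset.sum_congr rfl fun p _ => ?_
    push_cast
    split_ifs with h
    · rw [Matrix.smul_mul, Matrix.trace_smul, trace_matTensor_mul]
      simp only [hqc, smul_eq_mul, Complex.ofReal_one, mul_one]
    · simp
  rw [htr, Complex.ofReal_re]
  refine lt_of_lt_of_le ?_ main
  have hb : (m * K2 + m ^ 2 * δ ^ 3 * (1 + K2) ^ 2) / (m * ε) ^ 2 < ε := by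
    rw [div_lt_iff₀ (by positivity)]
    have a1 : δ ≤ 1 := hδ0.trans (min_le_left _ _)
    have a2 : δ * (4 * (1 + K2) ^ 2) ≤ ε ^ 3 := by
      rw [← le_div_iff₀ hKp]; exact hδ0.trans (min_le_right _ _)
    have a3 : δ ^ 3 ≤ δ := by
      have : δ ^ 3 ≤ δ ^ 1 := pow_le_pow_of_le_one hδ.le a1 (by norm_num)
      simpa using this
    have a4 : δ ^ 3 * (1 + K2) ^ 2 ≤ ε ^ 3 / 4 := by
      have := mul_le_mul_of_nonneg_right a3 (sq_nonneg (1 + K2))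
      linarith
    have a5 : 4 * K2 ≤ m * ε ^ 3 := by
      rw [← div_le_iff₀ (by positivity)]
      refine (Nat.le_ceil _).trans ?_
      exact_mod_cast (by omega : ⌈4 * K2 / ε ^ 3⌉₊ ≤ m)
    have a6 := mul_le_mul_of_nonneg_left a4 (sq_nonneg (m : ℝ))
    have a7 := mul_le_mul_of_nonneg_left a5 hmR.le
    have a8 : 0 < (m : ℝ) ^ 2 * ε ^ 3 := by positivity
    linarith
  linarith
end

section
/- Sandwich bound on the entropy-typical subspace for Markov-correlated states: For k = 1,…,m let τ_k := ∑_{i∈I} γ_i σ_k(i), with spectral decomposition τ_k = ∑_{p=1}^d λ_{k,p} π_{k,p} (orthonormal eigenbasis, π_{k,p} rank-one), and let Π_{ent,ε} be the entropy-typical projector on (ℂ^d)^{⊗m}: the sum, over all sequences (p_1,…,p_m) with λ_{k,p_k} > 0 for every k and |∑_{k=1}^m (log₂ λ_{k,p_k} + S(τ_k))| ≤ m ε, of ⊗_{k=1}^m π_{k,p_k}. Assume the upper domination bound σ_k(i,i') ≤ (1+δ³) γ_{i'} σ_k(i) for all k,i,i', and assume log₂(1+δ³) ≤ ε. Then Π_{ent,ε}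 σ^{(m)} Π_{ent,ε} ≤ 2^{−∑_{k=1}^m S(τ_k) + 2mε} · Π_{ent,ε} in the Loewner order. -/
open scoped BigOperators ComplexOrder Matrix

theorem matTensor_mul {m d : ℕ} (A B : Fin m → Matrix (Fin d) (Fin d) ℂ) :
    matTensor A * matTensor B = matTensor (fun k => A k * B k) := by
  ext x y
  simp only [matTensor, Matrix.mul_apply, Matrix.of_apply, ← Finset.prod_mul_distrib]
  rw [Finset.prod_univ_sum, Fintype.piFinset_univ]

theorem matTensor_sum {m d : ℕ} {J : Type*} [Fintype J]
    (A : Fin m → J → Matrix (Fin d) (Fin d) ℂ) :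
    matTensor (fun k => ∑ j, A k j) = ∑ p : Fin m → J, matTensor (fun k => A k (p k)) := by
  classical
  ext x y
  simp only [matTensor, Matrix.sum_apply, Matrix.of_apply]
  rw [Finset.prod_univ_sum, Fintype.piFinset_univ]

theorem matTensor_smul {m d : ℕ} (c : Fin m → ℂ) (A : Fin m → Matrix (Fin d) (Fin d) ℂ) :
    matTensor (fun k => c k • A k) = (∏ k, c k) • matTensor A := by
  ext x y
  simp [matTensor, Finset.prod_mul_distrib]

theorem matTensor_posSemidef {m d : ℕ} (A : Fin m → Matrix (Fin d) (Fin d) ℂ)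
    (hA : ∀ k, (A k).PosSemidef) : (matTensor A).PosSemidef := by
  have h : ∀ k, ∃ B : Matrix (Fin d) (Fin d) ℂ, A k = Bᴴ * B := fun k => by
    open scoped MatrixOrder in
    obtain ⟨B, hB⟩ := CStarAlgebra.nonneg_iff_eq_star_mul_self.mp (hA k).nonneg
    exact ⟨B, hB⟩
  choose B hB using h
  have : matTensor A = (matTensor B)ᴴ * matTensor B := by
    have h1 : (matTensor B)ᴴ = matTensor (fun k => (B k)ᴴ) := by
      ext x y
      simp [matTensor, Matrix.conjTranspose_apply]
    rw [h1, matTensor_mul]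
    congr 1
    funext k
    exact hB k
  rw [this]
  exact Matrix.posSemidef_conjTranspose_mul_self _

theorem posSemidef_fsum {n J : Type*} [Fintype n] (s : Finset J) (f : J → Matrix n n ℂ)
    (h : ∀ j ∈ s, (f j).PosSemidef) : (∑ j ∈ s, f j).PosSemidef := by
  classical
  induction s using Finset.induction_on with
  | empty => simpa using Matrix.PosSemidef.zero
  | insert a s ha ih =>
    rw [Finset.sum_insert ha]
    exact (h a (by simp)).add (ih fun j hj => h j (by simp [hj]))

theorem matTensor_mono {m d : ℕ} (A B : Fin m → Matrix (Fin d) (Fin d) ℂ)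
    (hA : ∀ k, (A k).PosSemidef) (hB : ∀ k, (B k - A k).PosSemidef) :
    (matTensor B - matTensor A).PosSemidef := by
  classical
  have key : matTensor B = ∑ s : Finset (Fin m),
      matTensor (fun k => if k ∈ s then A k else B k - A k) := by
    ext x y
    simp only [matTensor, Matrix.sum_apply, Matrix.of_apply]
    have : ∀ k, B k (x k) (y k) = A k (x k) (y k) + (B k - A k) (x k) (y k) := by
      intro k; simp
    rw [Finset.prod_congr rfl fun k _ => this k, Finset.prod_add, Finset.powerset_univ]
    refine Finset.sum_congr rfl fun s _ => ?_
    have h2 : ∀ k, (if k ∈ s then A k else B k - A k) (x k) (y k)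
        = if k ∈ s then A k (x k) (y k) else (B k - A k) (x k) (y k) := by
      intro k; split_ifs <;> rfl
    rw [Finset.prod_congr rfl fun k _ => h2 k, Finset.prod_ite]
    congr 1
    · congr 1; ext; simp
    · congr 1; ext; simp
  have h3 : matTensor A
      = matTensor (fun k => if k ∈ (Finset.univ : Finset (Fin m)) then A k else B k - A k) := by
    simp
  rw [key, ← Finset.add_sum_erase _ _ (Finset.mem_univ (Finset.univ : Finset (Fin m))), ← h3,
    add_sub_cancel_left]
  refine posSemidef_fsum _ _ fun s _ => matTensor_posSemidef _ fun k => ?_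
  split_ifs
  · exact hA k
  · exact hB k

theorem outerProj_mul {d : ℕ} (u v : Fin d → ℂ) (c : ℂ) (h : star u ⬝ᵥ v = c) :
    outerProj u * outerProj v = c • Matrix.vecMulVec u (star v) := by
  subst h
  rw [outerProj, outerProj, Matrix.vecMulVec_mul_vecMulVec]
  ext x y
  simp [Matrix.vecMulVec_apply]
  ring

theorem tensorProj_mul {d m : ℕ} (e : Fin m → Fin d → Fin d → ℂ)
    (horth : ∀ k p q, (star (e k p)) ⬝ᵥ e k q = if p = q then 1 else 0) (p q : Fin m → Fin d) :
    matTensor (fun k => outerProj (e k (p k))) * matTensor (fun k => outerProj (e k (q k)))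
      = if p = q then matTensor (fun k => outerProj (e k (p k))) else 0 := by
  rw [matTensor_mul]
  have h : ∀ k, outerProj (e k (p k)) * outerProj (e k (q k))
      = (if p k = q k then (1 : ℂ) else 0) • Matrix.vecMulVec (e k (p k)) (star (e k (q k))) :=
    fun k => outerProj_mul _ _ _ (horth k _ _)
  simp only [h]
  rw [matTensor_smul]
  split_ifs with hpq
  · subst hpq
    simp [outerProj]
  · obtain ⟨k, hk⟩ := Function.ne_iff.mp hpq
    rw [Finset.prod_eq_zero (Finset.mem_univ k) (by simp [hk]), zero_smul]

theorem diag_mul {n J : Type*} [Fintype n] [Fintype J] [DecidableEq J] (P : J → Matrix n n ℂ)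
    (hP : ∀ p q, P p * P q = if p = q then P p else 0) (a b : J → ℂ) :
    (∑ p, a p • P p) * (∑ p, b p • P p) = ∑ p, (a p * b p) • P p := by
  rw [Finset.sum_mul]
  refine Finset.sum_congr rfl fun p _ => ?_
  rw [Finset.mul_sum, Finset.sum_eq_single p]
  · simp [hP, smul_smul, mul_comm]
  · intro q _ hq
    simp [hP, hq.symm]
  · simp

theorem outerProj_posSemidef {d : ℕ} (v : Fin d → ℂ) : (outerProj v).PosSemidef :=
  Matrix.posSemidef_vecMulVec_self_star v

theorem chain_dom {I : Type*} [Fintype I] {d m : ℕ}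
    (γ : I → ℝ) (hγ0 : ∀ i, 0 ≤ γ i) (hγ1 : ∑ i, γ i = 1) (r : ℝ)
    (σ : Fin m → I → I → Matrix (Fin d) (Fin d) ℂ)
    (hpsd : ∀ k i i', (σ k i i').PosSemidef)
    (hdom : ∀ k i i',
      (((r * γ i' : ℝ) : ℂ) • (∑ i'', σ k i i'') - σ k i i').PosSemidef) :
    ((r ^ m : ℂ) • matTensor (fun k => ∑ i, (γ i : ℂ) • ∑ i', σ k i i')
      - sigmaChain γ σ).PosSemidef := by
  have key : (r ^ m : ℂ) • matTensor (fun k => ∑ i, (γ i : ℂ) • ∑ i', σ k i i')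
      = ∑ i : Fin (m + 1) → I, (γ (i 0) : ℂ) • matTensor (fun k =>
          ((r * γ (i k.succ) : ℝ) : ℂ) • ∑ i'', σ k (i k.castSucc) i'') := by
    have h1 : ∀ i : Fin (m + 1) → I, (γ (i 0) : ℂ) • matTensor (fun k =>
          ((r * γ (i k.succ) : ℝ) : ℂ) • ∑ i'', σ k (i k.castSucc) i'')
        = ((r ^ m : ℂ) * ∏ k, (γ (i k) : ℂ)) •
          matTensor (fun k => ∑ i'', σ k (i k.castSucc) i'') := by
      intro i
      rw [matTensor_smul, smul_smul, Fin.prod_univ_succ]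
      congr 1
      push_cast
      rw [Finset.prod_mul_distrib]
      simp
      ring
    simp only [h1, mul_smul, ← Finset.smul_sum]
    congr 1
    rw [matTensor_sum, ← (Fin.snocEquiv (fun _ : Fin (m + 1) => I)).sum_comp,
      Fintype.sum_prod_type_right]
    refine Finset.sum_congr rfl fun p _ => ?_
    have h2 : ∀ j : I, (∏ k, (γ ((Fin.snocEquiv (fun _ : Fin (m + 1) => I)) (j, p) k) : ℂ)) •
        matTensor (fun k => ∑ i'', σ k
          ((Fin.snocEquiv (fun _ : Fin (m + 1) => I)) (j, p) k.castSucc) i'')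
        = (γ j : ℂ) • ((∏ k, (γ (p k) : ℂ)) • matTensor (fun k => ∑ i'', σ k (p k) i'')) := by
      intro j
      rw [Fin.prod_univ_castSucc, smul_smul]
      simp [Fin.snocEquiv, mul_comm]
    rw [Finset.sum_congr rfl fun j _ => h2 j, ← Finset.sum_smul, ← Complex.ofReal_sum, hγ1,
      matTensor_smul]
    simp
  rw [key, sigmaChain, ← Finset.sum_sub_distrib]
  refine posSemidef_fsum _ _ fun i _ => ?_
  rw [← smul_sub]
  refine (matTensor_mono _ _ (fun k => hpsd k _ _) fun k => hdom k _ _).smul ?_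
  exact_mod_cast hγ0 _

/-- Sandwich bound on the entropy-typical subspace for Markov-correlated states: under
conditions (i), (ii), the upper domination bound `σ_k(i,i') ≤ (1+δ³) γ_{i'} σ_k(i)`, and
`log₂(1+δ³) ≤ ε`, one has
`Π_{ent,ε} σ^{(m)} Π_{ent,ε} ≤ 2^{−∑ₖ S(τ_k) + 2mε} Π_{ent,ε}` in the Loewner order. -/
theorem entTypicalProj_sandwich {I : Type*} [Fintype I] {d m : ℕ}
    (γ : I → ℝ) (hγ0 : ∀ i, 0 ≤ γ i) (hγ1 : ∑ i, γ i = 1) (δ ε : ℝ) (hδ : 0 < δ)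
    (σ : Fin m → I → I → Matrix (Fin d) (Fin d) ℂ)
    (hpsd : ∀ k i i', (σ k i i').PosSemidef)
    (hi : ∀ k i', ∑ i, (γ i : ℂ) * Matrix.trace (σ k i i') = (γ i' : ℂ))
    (hii : ∀ k i, Matrix.trace (∑ i', σ k i i') = 1)
    (hdom : ∀ k i i',
      ((((1 + δ ^ 3) * γ i' : ℝ) : ℂ) • (∑ i'', σ k i i'') - σ k i i').PosSemidef)
    (e : Fin m → Fin d → Fin d → ℂ) (lam : Fin m → Fin d → ℝ)
    (horth : ∀ k p q, (star (e k p)) ⬝ᵥ e k q = if p = q then 1 else 0)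
    (hspec : ∀ k, ∑ i, (γ i : ℂ) • ∑ i', σ k i i' = ∑ p, (lam k p : ℂ) • outerProj (e k p))
    (hδε : Real.logb 2 (1 + δ ^ 3) ≤ ε) :
    ((((2 : ℝ) ^ (-(∑ k, shannonEntropy (lam k)) + 2 * m * ε) : ℝ) : ℂ) •
        entTypicalProj e lam ε -
      entTypicalProj e lam ε * sigmaChain γ σ * entTypicalProj e lam ε).PosSemidef := by
  classical
  set P : (Fin m → Fin d) → Matrix (Fin m → Fin d) (Fin m → Fin d) ℂ :=
    fun p => matTensor fun k => outerProj (e k (p k)) with hPdef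
  have hP : ∀ p q, P p * P q = if p = q then P p else 0 := tensorProj_mul e horth
  have hPpsd : ∀ p, (P p).PosSemidef := fun p =>
    matTensor_posSemidef _ fun k => outerProj_posSemidef _
  set T : (Fin m → Fin d) → Prop := fun p => (∀ k, 0 < lam k (p k)) ∧
        |∑ k, (Real.logb 2 (lam k (p k)) + shannonEntropy (lam k))| ≤ m * ε with hT
  set c : (Fin m → Fin d) → ℂ := fun p => if T p then 1 else 0 with hc
  have hPi : entTypicalProj e lam ε = ∑ p, c p • P p := by
    rw [entTypicalProj]
    refine Finset.sum_congr rfl fun p _ => ?_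
    by_cases h : T p
    · rw [if_pos h]; simp [hc, h, hPdef]
    · rw [if_neg h]; simp [hc, h]
  have hherm : (entTypicalProj e lam ε)ᴴ = entTypicalProj e lam ε := by
    have : (entTypicalProj e lam ε).PosSemidef := by
      rw [hPi]
      refine posSemidef_fsum _ _ fun p _ => (hPpsd p).smul ?_
      simp only [hc]; split_ifs <;> simp
    exact this.isHermitian
  have hr : (0 : ℝ) < 1 + δ ^ 3 := by positivity
  have hchain := chain_dom γ hγ0 hγ1 (1 + δ ^ 3) σ hpsd hdom
  have htau : matTensor (fun k => ∑ i, (γ i : ℂ) • ∑ i', σ k i i')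
      = ∑ p, (∏ k, (lam k (p k) : ℂ)) • P p := by
    simp only [hspec]
    rw [matTensor_sum]
    refine Finset.sum_congr rfl fun p _ => ?_
    rw [matTensor_smul]
  have h1 := hchain.conjTranspose_mul_mul_same (entTypicalProj e lam ε)
  rw [hherm, htau, mul_sub, sub_mul] at h1
  set C : ℝ := (2 : ℝ) ^ (-(∑ k, shannonEntropy (lam k)) + 2 * m * ε) with hC
  have h2 : ((C : ℂ) • entTypicalProj e lam ε - entTypicalProj e lam ε *
      ((((1 + δ ^ 3 : ℝ) : ℂ) ^ m) • ∑ p, (∏ k, (lam k (p k) : ℂ)) • P p) *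
        entTypicalProj e lam ε).PosSemidef := by
    rw [hPi, Finset.smul_sum, Finset.smul_sum]
    simp only [smul_smul]
    rw [diag_mul P hP, diag_mul P hP, ← Finset.sum_sub_distrib]
    refine posSemidef_fsum _ _ fun p _ => ?_
    rw [← sub_smul]
    refine (hPpsd p).smul ?_
    by_cases h : T p
    · have hcp : c p = 1 := by simp [hc, h]
      rw [hcp, mul_one, one_mul, mul_one, sub_nonneg]
      have hreal : (1 + δ ^ 3) ^ m * ∏ k, lam k (p k) ≤ C := by
        obtain ⟨hpos, habs⟩ := h
        have hup := (abs_le.mp habs).2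
        have hprod : 0 < ∏ k, lam k (p k) := Finset.prod_pos fun k _ => hpos k
        rw [hC, ← Real.logb_le_iff_le_rpow (by norm_num) (by positivity),
          Real.logb_mul (by positivity) hprod.ne', Real.logb_pow,
          Real.logb_prod _ _ (fun k _ => (hpos k).ne')]
        rw [Finset.sum_add_distrib] at hup
        have : (m : ℝ) * Real.logb 2 (1 + δ ^ 3) ≤ m * ε := by gcongr
        linarith
      exact_mod_cast hreal
    · simp [hc, h]
  have h3 := h2.add h1
  rwa [sub_add_sub_cancel] at h3
end

section
/- Union bound for tensor products of contractions: For k = 1,…,r let Q_k be a Hermitian d_k×d_k complex matrix with 0 ≤ Q_k ≤ 1 in the Loewner order (for instance an orthogonal projection). On the tensor product space ℂ^{d_1} ⊗ ⋯ ⊗ ℂ^{d_r}, let Q̂_k denote 1 ⊗ ⋯ ⊗ 1 ⊗ Q_k ⊗ 1 ⊗ ⋯ ⊗ 1 (Q_k in the k-th factor). Then Q_1 ⊗ Q_2 ⊗ ⋯ ⊗ Q_r ≥ 1 − ∑_{k=1}^r (1 − Q̂_k) in the Loewner order. -/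
open scoped BigOperators ComplexOrder Matrix

/-- The tensor product `A₁ ⊗ ⋯ ⊗ A_r` of square matrices of sizes `d k`, realised as a
matrix on the index type `Π k, Fin (d k)`. -/
noncomputable def tprodHet {r : ℕ} {d : Fin r → ℕ}
    (A : ∀ k, Matrix (Fin (d k)) (Fin (d k)) ℂ) :
    Matrix (∀ k, Fin (d k)) (∀ k, Fin (d k)) ℂ :=
  Matrix.of fun x y => ∏ k, A k (x k) (y k)

/-- `Q̂_k`: the operator `1 ⊗ ⋯ ⊗ 1 ⊗ Q_k ⊗ 1 ⊗ ⋯ ⊗ 1` with `Q_k` in the `k`-th tensor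
factor. -/
noncomputable def embedFactor {r : ℕ} {d : Fin r → ℕ}
    (Q : ∀ k, Matrix (Fin (d k)) (Fin (d k)) ℂ) (k : Fin r) :
    Matrix (∀ j, Fin (d j)) (∀ j, Fin (d j)) ℂ :=
  tprodHet (fun j => if j = k then Q j else 1)

theorem tprodHet_mul {r : ℕ} {d : Fin r → ℕ}
    (A B : ∀ k, Matrix (Fin (d k)) (Fin (d k)) ℂ) :
    tprodHet (fun k => A k * B k) = tprodHet A * tprodHet B := by
  ext x y
  simp only [tprodHet, Matrix.of_apply, Matrix.mul_apply]
  rw [Finset.prod_univ_sum, Fintype.piFinset_univ]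
  exact Finset.sum_congr rfl fun z _ => Finset.prod_mul_distrib

theorem tprodHet_conjTranspose {r : ℕ} {d : Fin r → ℕ}
    (A : ∀ k, Matrix (Fin (d k)) (Fin (d k)) ℂ) :
    tprodHet (fun k => (A k)ᴴ) = (tprodHet A)ᴴ := by
  ext x y
  simp [tprodHet, Matrix.conjTranspose_apply]

theorem tprodHet_one {r : ℕ} {d : Fin r → ℕ} :
    tprodHet (fun k => (1 : Matrix (Fin (d k)) (Fin (d k)) ℂ)) = 1 := by
  ext x y
  simp only [tprodHet, Matrix.of_apply, Matrix.one_apply, funext_iff]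
  rw [Fintype.prod_ite_zero]
  simp

open scoped MatrixOrder in
theorem tprodHet_posSemidef {r : ℕ} {d : Fin r → ℕ}
    (A : ∀ k, Matrix (Fin (d k)) (Fin (d k)) ℂ) (hA : ∀ k, (A k).PosSemidef) :
    (tprodHet A).PosSemidef := by
  have h : ∀ k, ∃ B : Matrix (Fin (d k)) (Fin (d k)) ℂ, A k = Bᴴ * B := fun k =>
    CStarAlgebra.nonneg_iff_eq_star_mul_self.mp (hA k).nonneg
  choose B hB using h
  have : A = fun k => (B k)ᴴ * B k := funext hB
  rw [this, tprodHet_mul (fun k => (B k)ᴴ) B, tprodHet_conjTranspose]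
  exact Matrix.posSemidef_conjTranspose_mul_self _

theorem tprodHet_update_sub {r : ℕ} {d : Fin r → ℕ}
    (A : ∀ k, Matrix (Fin (d k)) (Fin (d k)) ℂ) (a : Fin r)
    (X Y : Matrix (Fin (d a)) (Fin (d a)) ℂ) :
    tprodHet (Function.update A a (X - Y)) =
      tprodHet (Function.update A a X) - tprodHet (Function.update A a Y) := by
  have key : ∀ (Z : Matrix (Fin (d a)) (Fin (d a)) ℂ) (x y : ∀ k, Fin (d k)),
      tprodHet (Function.update A a Z) x y =
        Z (x a) (y a) * ∏ k ∈ Finset.univ.erase a, A k (x k) (y k) := by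
    intro Z x y
    simp only [tprodHet, Matrix.of_apply]
    rw [← Finset.mul_prod_erase _ _ (Finset.mem_univ a), Function.update_self]
    congr 1
    refine Finset.prod_congr rfl fun k hk => ?_
    rw [Function.update_of_ne (Finset.ne_of_mem_erase hk)]
  ext x y
  rw [Matrix.sub_apply, key, key, key, Matrix.sub_apply, sub_mul]

theorem tprodHet_mono {r : ℕ} {d : Fin r → ℕ}
    (A B : ∀ k, Matrix (Fin (d k)) (Fin (d k)) ℂ) (hA : ∀ k, (A k).PosSemidef)
    (hB : ∀ k, (B k).PosSemidef) (hAB : ∀ k, (B k - A k).PosSemidef) :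
    (tprodHet B - tprodHet A).PosSemidef := by
  have h : ∀ s : Finset (Fin r), (tprodHet (s.piecewise B A) - tprodHet A).PosSemidef := by
    intro s
    induction s using Finset.induction_on with
    | empty => simpa using Matrix.PosSemidef.zero
    | insert a s ha ih =>
      have h1 : Function.update (s.piecewise B A) a (A a) = s.piecewise B A := by
        rw [Function.update_eq_self_iff, Finset.piecewise_eq_of_notMem _ _ _ ha]
      have h2 := tprodHet_update_sub (s.piecewise B A) a (B a) (A a)
      rw [h1] at h2
      have h3 : (tprodHet (Function.update (s.piecewise B A) a (B a - A a))).PosSemidef := by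
        apply tprodHet_posSemidef
        intro k
        by_cases hk : k = a
        · subst hk
          simpa using hAB k
        · rw [Function.update_of_ne hk]
          by_cases hs : k ∈ s
          · simpa [hs] using hB k
          · simpa [hs] using hA k
      rw [Finset.piecewise_insert]
      have := h3.add ih
      rw [h2] at this
      simpa using this
  simpa using h Finset.univ

theorem tensor_union_bound_aux {r : ℕ} (d : Fin r → ℕ)
    (Q : ∀ k, Matrix (Fin (d k)) (Fin (d k)) ℂ)
    (hQ : ∀ k, (Q k).PosSemidef)
    (hQ1 : ∀ k, ((1 : Matrix (Fin (d k)) (Fin (d k)) ℂ) - Q k).PosSemidef)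
    (s : Finset (Fin r)) :
    (tprodHet (s.piecewise Q fun _ => 1) -
      ((1 : Matrix (∀ k, Fin (d k)) (∀ k, Fin (d k)) ℂ) -
        ∑ k ∈ s, ((1 : Matrix (∀ j, Fin (d j)) (∀ j, Fin (d j)) ℂ) -
          embedFactor Q k))).PosSemidef := by
  induction s using Finset.induction_on with
  | empty => simpa [tprodHet_one] using Matrix.PosSemidef.zero
  | insert a s ha ih =>
    have h1 : Function.update (s.piecewise Q fun _ => 1) a 1 = s.piecewise Q fun _ => 1 := by
      rw [Function.update_eq_self_iff, Finset.piecewise_eq_of_notMem _ _ _ ha]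
    have h2 := tprodHet_update_sub (s.piecewise Q fun _ => 1) a 1 (Q a)
    rw [h1] at h2
    have h3 := tprodHet_update_sub (d := d) (fun _ => 1) a 1 (Q a)
    have h4 : Function.update (fun k => (1 : Matrix (Fin (d k)) (Fin (d k)) ℂ)) a 1 =
        fun _ => 1 := by
      rw [Function.update_eq_self_iff]
    have h5 : tprodHet (Function.update (fun k => (1 : Matrix (Fin (d k)) (Fin (d k)) ℂ))
        a (Q a)) = embedFactor Q a := by
      unfold embedFactor
      congr 1
      funext j
      by_cases hj : j = a
      · subst hj
        simp
      · simp [hj]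
    rw [h4, h5, tprodHet_one] at h3
    have h6 := tprodHet_mono (Function.update (s.piecewise Q fun _ => 1) a (1 - Q a))
      (Function.update (fun k => (1 : Matrix (Fin (d k)) (Fin (d k)) ℂ)) a (1 - Q a))
      (by
        intro k
        by_cases hk : k = a
        · subst hk
          simpa using hQ1 k
        · rw [Function.update_of_ne hk]
          by_cases hs : k ∈ s
          · simpa [hs] using hQ k
          · simpa [hs] using Matrix.PosSemidef.one)
      (by
        intro k
        by_cases hk : k = a
        · subst hk
          simpa using hQ1 k
        · rw [Function.update_of_ne hk]
          exact Matrix.PosSemidef.one)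
      (by
        intro k
        by_cases hk : k = a
        · subst hk
          simpa using Matrix.PosSemidef.zero
        · rw [Function.update_of_ne hk, Function.update_of_ne hk]
          by_cases hs : k ∈ s
          · simpa [hs] using hQ1 k
          · simpa [hs] using Matrix.PosSemidef.zero)
    rw [h2, h3] at h6
    rw [Finset.piecewise_insert, Finset.sum_insert ha]
    convert h6.add ih using 1
    abel

/-- Union bound for tensor products of contractions: if `0 ≤ Q_k ≤ 1` for each `k`, then
`Q₁ ⊗ ⋯ ⊗ Q_r ≥ 1 − ∑ₖ (1 − Q̂_k)` in the Loewner order. -/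
theorem tensor_union_bound {r : ℕ} (d : Fin r → ℕ)
    (Q : ∀ k, Matrix (Fin (d k)) (Fin (d k)) ℂ)
    (hQ : ∀ k, (Q k).PosSemidef)
    (hQ1 : ∀ k, ((1 : Matrix (Fin (d k)) (Fin (d k)) ℂ) - Q k).PosSemidef) :
    (tprodHet Q -
      ((1 : Matrix (∀ k, Fin (d k)) (∀ k, Fin (d k)) ℂ) -
        ∑ k, ((1 : Matrix (∀ j, Fin (d j)) (∀ j, Fin (d j)) ℂ) - embedFactor Q k))).PosSemidef := by
  simpa using tensor_union_bound_aux d Q hQ hQ1 Finset.univ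
end
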